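/- arXiv:1408.4356 — 2 statements merged into one kernel-verified Lean document; each statement's English description precedes it below -/
import Mathlib

section
/- Let X ⊆ ℝ^n be open and let W ⊆ ℝ^n be a nonzero linear subspace. Then the following are equivalent: (i) the boundary distance d_X satisfies the minimum principle in x+W for each x ∈ X; (ii) for each nonempty compact subset K ⊆ X and every x ∈ X with d_X(x) < dist(K, ℝ^n \ X), there is a W-regular curve γ : [0,∞) → X with γ(0) = x, whose image does not intersect K, and which approaches the boundary of X in the one-point compactification. -/
open Set Filter

/-- Piecewise continuously differentiable on `[a,b]`. -/
def PiecewiseC1On {E : Type*} [NormedAddCommGroup E] [NormedSpace ℝ E]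
    (γ : ℝ → E) (a b : ℝ) : Prop :=
  ∃ (k : ℕ) (t : Fin (k + 1) → ℝ), StrictMono t ∧ t 0 = a ∧ t (Fin.last k) = b ∧
    ∀ j : Fin k, ContDiffOn ℝ 1 γ (Set.Icc (t j.castSucc) (t j.succ))

/-- `W`-regular curve on the interval `I`. -/
def WRegularOn {E : Type*} [NormedAddCommGroup E] [NormedSpace ℝ E]
    (W : Submodule ℝ E) (γ : ℝ → E) (I : Set ℝ) : Prop :=
  ContinuousOn γ I ∧
  (∀ a b : ℝ, a ∈ I → b ∈ I → a < b → PiecewiseC1On γ a b) ∧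
  (∀ t ∈ I, DifferentiableAt ℝ γ t → deriv γ t ∈ W)

/-- `γ` approaches the boundary of `X` in the one-point compactification. -/
def ApproachesBoundary {E : Type*} [NormedAddCommGroup E]
    (X : Set E) (γ : ℝ → E) : Prop :=
  ∃ u : ℕ → ℝ, Filter.Tendsto u Filter.atTop Filter.atTop ∧
    (Filter.Tendsto (fun j => Metric.infDist (γ (u j)) Xᶜ) Filter.atTop (nhds 0) ∨
      Filter.Tendsto (fun j => ‖γ (u j)‖) Filter.atTop Filter.atTop)

/-- The boundary of `S` in the subspace topology of `F`, viewed as a subset of the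
ambient space. -/
def bdryIn {E : Type*} [TopologicalSpace E] (F S : Set E) : Set E :=
  Subtype.val '' (frontier ((Subtype.val ⁻¹' S) : Set F))

/-- `f` satisfies the minimum principle in `F` (relative to `X`). -/
def MinPrinciple {E : Type*} [TopologicalSpace E] (f : E → ℝ) (X F : Set E) : Prop :=
  ∀ K : Set E, K ⊆ F ∩ X → IsCompact K → K.Nonempty →
    sInf (f '' K) = sInf (f '' bdryIn F K)

open scoped Topology

/-- `a` and `b` are joined inside `S` by a `C¹` curve which is constant outside `[0,1]`. -/
def SmoothlyJoinedIn {E : Type*} [NormedAddCommGroup E] [NormedSpace ℝ E]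
    (S : Set E) (a b : E) : Prop :=
  ∃ c : ℝ → E, ContDiff ℝ 1 c ∧ (∀ t ≤ 0, c t = a) ∧ (∀ t, 1 ≤ t → c t = b) ∧ ∀ t, c t ∈ S

namespace SmoothlyJoinedIn

variable {E : Type*} [NormedAddCommGroup E] [NormedSpace ℝ E] {S : Set E} {a b p : E}

theorem mem_right (h : SmoothlyJoinedIn S a b) : b ∈ S := by
  obtain ⟨c, -, -, h1, hS⟩ := h
  exact h1 1 le_rfl ▸ hS 1

theorem symm (h : SmoothlyJoinedIn S a b) : SmoothlyJoinedIn S b a := by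
  obtain ⟨c, hc, h0, h1, hS⟩ := h
  refine ⟨fun t => c (1 - t), by fun_prop, fun t ht => h1 _ (by linarith),
    fun t ht => h0 _ (by linarith), fun t => hS _⟩

theorem trans (h : SmoothlyJoinedIn S a b) (h' : SmoothlyJoinedIn S b p) :
    SmoothlyJoinedIn S a p := by
  obtain ⟨c, hc, h0, h1, hS⟩ := h
  obtain ⟨c', hc', h0', h1', hS'⟩ := h'
  refine ⟨fun t => c (2 * t) + (c' (2 * t - 1) - b), by fun_prop, fun t ht => ?_,
    fun t ht => ?_, fun t => ?_⟩
  · simp [h0 (2 * t) (by linarith), h0' (2 * t - 1) (by linarith)]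
  · simp [h1 (2 * t) (by linarith), h1' (2 * t - 1) (by linarith)]
  · rcases le_total (2 * t) 1 with ht | ht
    · simpa [h0' (2 * t - 1) (by linarith)] using hS (2 * t)
    · simpa [h1 (2 * t) (by linarith)] using hS' (2 * t - 1)

theorem of_segment_subset (h : segment ℝ a b ⊆ S) : SmoothlyJoinedIn S a b := by
  refine ⟨fun t => a + Real.smoothTransition t • (b - a), ?_, fun t ht => ?_, fun t ht => ?_,
    fun t => h ?_⟩
  · have : ContDiff ℝ 1 Real.smoothTransition := Real.smoothTransition.contDiff (n := 1)
    fun_prop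
  · simp [Real.smoothTransition.zero_of_nonpos ht]
  · simp [Real.smoothTransition.one_of_one_le ht]
  · rw [segment_eq_image']
    exact ⟨_, ⟨Real.smoothTransition.nonneg t, Real.smoothTransition.le_one t⟩, rfl⟩

theorem exists_contDiff_interpolating {y : ℕ → E}
    (h : ∀ k, SmoothlyJoinedIn S (y k) (y (k + 1))) :
    ∃ γ : ℝ → E, ContDiff ℝ 1 γ ∧ (∀ t, γ t ∈ S) ∧ ∀ k : ℕ, γ k = y k := by
  choose c hc h0 h1 hS using h
  let g : ℕ → ℝ → E := fun N t => y 0 + ∑ k ∈ Finset.range N, (c k (t - k) - y k)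
  let γ : ℝ → E := fun t => g ⌈t⌉₊ t
  have hg : ∀ (N : ℕ) (t : ℝ), t ≤ N → γ t = g N t := by
    intro N t ht
    simp only [γ, g]
    congr 1
    refine Finset.sum_subset (Finset.range_mono (Nat.ceil_le.2 ht)) fun k _ hk => ?_
    rw [Finset.mem_range, not_lt, Nat.ceil_le] at hk
    rw [h0 k _ (by linarith), sub_self]
  have hpiece : ∀ (N : ℕ) (t : ℝ), N ≤ t → t ≤ N + 1 → γ t = c N (t - N) := by
    intro N t hN ht
    rw [hg (N + 1) t (by exact_mod_cast ht)]
    have : ∑ k ∈ Finset.range N, (c k (t - k) - y k) = y N - y 0 := by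
      rw [← Finset.sum_range_sub]
      refine Finset.sum_congr rfl fun k hk => ?_
      have : (k : ℝ) + 1 ≤ N := by exact_mod_cast Finset.mem_range.1 hk
      rw [h1 k _ (by linarith)]
    simp only [g]
    rw [Finset.sum_range_succ, this]
    abel
  refine ⟨γ, contDiff_iff_contDiffAt.2 fun t => ?_, fun t => ?_, fun k => ?_⟩
  · obtain ⟨N, hN⟩ := exists_nat_gt t
    have hsmooth : ContDiff ℝ 1 (g N) := by
      refine contDiff_const.add (ContDiff.sum fun k _ => ?_)
      have := hc k
      fun_prop
    refine hsmooth.contDiffAt.congr_of_eventuallyEq ?_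
    filter_upwards [Iio_mem_nhds hN] with s hs using hg N s (le_of_lt hs)
  · rcases le_total t 0 with ht | ht
    · rw [hg 0 t (by simpa using ht)]
      simpa [g, h0 0 0 le_rfl] using hS 0 0
    · rw [hpiece ⌊t⌋₊ t (Nat.floor_le ht) (Nat.lt_floor_add_one t).le]
      exact hS _ _
  · rw [hpiece k k le_rfl (by linarith), sub_self, h0 k 0 le_rfl]

end SmoothlyJoinedIn

theorem mem_bdryIn_iff {E : Type*} [TopologicalSpace E] {F K : Set E} (hK : IsClosed K) {p : E} :
    p ∈ bdryIn F K ↔ p ∈ F ∧ p ∈ K ∧ K ∉ 𝓝[F] p := by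
  have hcl : IsClosed ((Subtype.val ⁻¹' K) : Set F) := hK.preimage continuous_subtype_val
  simp only [bdryIn, mem_image, hcl.frontier_eq, Subtype.exists, Set.mem_sdiff, mem_preimage,
    mem_interior_iff_mem_nhds, preimage_coe_mem_nhds_subtype]
  constructor
  · rintro ⟨q, hq, ⟨h1, h2⟩, rfl⟩
    exact ⟨hq, h1, h2⟩
  · rintro ⟨hp, h1, h2⟩
    exact ⟨p, hp, ⟨h1, h2⟩, rfl⟩

theorem bdryIn_subset {E : Type*} [TopologicalSpace E] {F K : Set E} (hK : IsClosed K) :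
    bdryIn F K ⊆ K := fun _ hp => ((mem_bdryIn_iff hK).1 hp).2.1

theorem IsClosed.bdryIn {E : Type*} [TopologicalSpace E] {F : Set E} (hF : IsClosed F)
    (K : Set E) : IsClosed (bdryIn F K) :=
  hF.isClosedEmbedding_subtypeVal.isClosedMap _ isClosed_frontier

theorem bdryIn_nonempty {E : Type*} [TopologicalSpace E] {F K : Set E} (hF : IsPreconnected F)
    (hKF : K ⊆ F) (hK : K.Nonempty) (hne : K ≠ F) : (bdryIn F K).Nonempty := by
  have : PreconnectedSpace F := Subtype.preconnectedSpace hF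
  refine (nonempty_frontier_iff.2 ⟨?_, fun h => hne (hKF.antisymm fun p hp => ?_)⟩).image _
  · obtain ⟨p, hp⟩ := hK
    exact ⟨⟨p, hKF hp⟩, hp⟩
  · have : (⟨p, hp⟩ : F) ∈ (Subtype.val ⁻¹' K : Set F) := h ▸ mem_univ _
    exact this

/-- A curve in `F` starting in a closed set `K` and avoiding its relative boundary stays in `K`. -/
theorem mapsTo_of_disjoint_bdryIn {E : Type*} [TopologicalSpace E] {F K : Set E} {γ : ℝ → E}
    (hK : IsClosed K) (hγ : ContinuousOn γ (Ici 0)) (hF : MapsTo γ (Ici 0) F) (h0 : γ 0 ∈ K)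
    (hd : ∀ t ∈ Ici (0 : ℝ), γ t ∉ bdryIn F K) : MapsTo γ (Ici 0) K := by
  intro b hb
  have hcl : IsClosed (γ ⁻¹' K ∩ Icc 0 b) := by
    rw [inter_comm]
    exact (hγ.mono Icc_subset_Ici_self).preimage_isClosed_of_isClosed isClosed_Icc hK
  refine hcl.Icc_subset_of_forall_mem_nhdsWithin h0 (fun t ht => ?_) ⟨hb, le_rfl⟩
  have ht0 : t ∈ Ici (0 : ℝ) := ht.2.1
  have hmem : K ∈ 𝓝[F] (γ t) := by
    by_contra hcon
    exact hd t ht0 ((mem_bdryIn_iff hK).2 ⟨hF ht0, ht.1, hcon⟩)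
  have hsub : Ioi t ⊆ Ici (0 : ℝ) := fun s hs => le_trans (mem_Ici.1 ht0) (le_of_lt (mem_Ioi.1 hs))
  exact nhdsWithin_mono t hsub (((hγ t ht0).tendsto_nhdsWithin hF) hmem)

theorem convex_coset {E : Type*} [NormedAddCommGroup E] [NormedSpace ℝ E]
    (W : Submodule ℝ E) (x : E) : Convex ℝ {y | y - x ∈ W} := by
  intro a ha b hb s t _ _ hst
  have : s • a + t • b - x = s • (a - x) + t • (b - x) := by
    rw [smul_sub, smul_sub, sub_add_sub_comm, ← add_smul, hst, one_smul]
  simpa only [mem_ofPred_eq, this] using W.add_mem (W.smul_mem s ha) (W.smul_mem t hb)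

theorem not_isBounded_coset {E : Type*} [NormedAddCommGroup E] [NormedSpace ℝ E]
    {W : Submodule ℝ E} (hW : W ≠ ⊥) (x : E) :
    ¬ Bornology.IsBounded {y | y - x ∈ W} := by
  intro hb
  obtain ⟨w, hw, hw0⟩ := W.exists_mem_ne_zero_of_ne_bot hW
  obtain ⟨R, hR⟩ := hb.exists_norm_le
  obtain ⟨N, hN⟩ := exists_nat_gt ((R + ‖x‖) / ‖w‖)
  have hpos : 0 < ‖w‖ := norm_pos_iff.2 hw0
  rw [div_lt_iff₀ hpos] at hN
  have h1 := hR (x + (N : ℝ) • w) (by simpa using W.smul_mem (N : ℝ) hw)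
  have h2 : ‖(N : ℝ) • w‖ ≤ ‖x + (N : ℝ) • w‖ + ‖x‖ := by
    simpa using norm_sub_le (x + (N : ℝ) • w) x
  rw [norm_smul, Real.norm_natCast] at h2
  linarith

theorem not_approachesBoundary {E : Type*} [NormedAddCommGroup E] {X K : Set E}
    {γ : ℝ → E} (hX : IsOpen X) (hXc : Xᶜ.Nonempty)
    (hKX : K ⊆ X) (hK : IsCompact K) (hγ : MapsTo γ (Ici 0) K) : ¬ ApproachesBoundary X γ := by
  rintro ⟨u, hu, h | h⟩
  · obtain ⟨p, hp, hmin⟩ := hK.exists_isMinOn ⟨_, hγ self_mem_Ici⟩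
      (Metric.continuous_infDist_pt Xᶜ).continuousOn
    have hpos : 0 < Metric.infDist p Xᶜ :=
      (hX.isClosed_compl.notMem_iff_infDist_pos hXc).1 (not_not_intro (hKX hp))
    refine hpos.not_ge (ge_of_tendsto h ?_)
    filter_upwards [hu.eventually_ge_atTop 0] with j hj using hmin (hγ hj)
  · obtain ⟨R, hR⟩ := hK.isBounded.exists_norm_le
    obtain ⟨j, hj, hj'⟩ := ((hu.eventually_ge_atTop 0).and (h.eventually_gt_atTop R)).exists
    exact hj'.not_ge (hR _ (hγ hj))

section InnerProductSpace

variable {E : Type*} [NormedAddCommGroup E] [InnerProductSpace ℝ E] [FiniteDimensional ℝ E]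

theorem sub_mem_of_deriv_mem {W : Submodule ℝ E} {γ : ℝ → E} {a b : ℝ} (hab : a < b)
    (hγ : ContDiffOn ℝ 1 γ (Icc a b))
    (hd : ∀ t ∈ Icc a b, DifferentiableAt ℝ γ t → deriv γ t ∈ W) : γ b - γ a ∈ W := by
  rw [← W.orthogonal_orthogonal, Submodule.mem_orthogonal]
  intro v hv
  have hdiff : ∀ t ∈ Ioo a b, DifferentiableAt ℝ γ t := fun t ht =>
    (hγ.differentiableOn one_ne_zero).differentiableAt (Icc_mem_nhds ht.1 ht.2)
  have hder : ∀ t ∈ Ioo a b, HasDerivAt (fun s => inner ℝ v (γ s)) (inner ℝ v (deriv γ t)) t := by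
    intro t ht
    simpa using (hasDerivAt_const t v).inner ℝ (hdiff t ht).hasDerivAt
  obtain ⟨t, ht, hslope⟩ := exists_deriv_eq_slope (fun s => inner ℝ v (γ s)) hab
    (continuousOn_const.inner hγ.continuousOn)
    (fun t ht => (hder t ht).differentiableAt.differentiableWithinAt)
  have hz : inner ℝ v (deriv γ t) = 0 :=
    Submodule.inner_left_of_mem_orthogonal (hd t (Ioo_subset_Icc_self ht) (hdiff t ht)) hv
  rw [(hder t ht).deriv, hz, eq_comm, div_eq_zero_iff] at hslope
  rw [inner_sub_right]
  exact hslope.resolve_right (sub_pos.2 hab).ne'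

theorem WRegularOn.sub_mem {W : Submodule ℝ E} {γ : ℝ → E} (h : WRegularOn W γ (Ici 0))
    {b : ℝ} (hb : 0 ≤ b) : γ b - γ 0 ∈ W := by
  rcases hb.eq_or_lt with rfl | hb'
  · simp
  obtain ⟨k, t, ht, h0, hk, hC⟩ := h.2.1 0 b self_mem_Ici hb hb'
  have key : ∀ j : Fin (k + 1), γ (t j) - γ 0 ∈ W := by
    intro j
    induction j using Fin.induction with
    | zero => simp [h0]
    | succ j ih =>
      have hj : 0 ≤ t j.castSucc := h0 ▸ ht.monotone (Fin.zero_le _)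
      have := sub_mem_of_deriv_mem (ht j.castSucc_lt_succ) (hC j)
        fun s hs => h.2.2 s (hj.trans hs.1)
      simpa using W.add_mem this ih
  exact hk ▸ key (Fin.last k)

theorem wRegularOn_of_contDiff {W : Submodule ℝ E} {γ : ℝ → E} {x : E} (hγ : ContDiff ℝ 1 γ)
    (hW : ∀ t, γ t - x ∈ W) (I : Set ℝ) : WRegularOn W γ I := by
  refine ⟨hγ.continuous.continuousOn, fun a b _ _ hab => ?_, fun t _ _ => ?_⟩
  · refine ⟨1, ![a, b], ?_, rfl, rfl, fun j => hγ.contDiffOn⟩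
    rw [Fin.strictMono_iff_lt_succ]
    intro j
    fin_cases j
    simpa using hab
  · have h1 := range_deriv_subset_closure_span_image (𝕜 := ℝ) (fun t => γ t - x) dense_univ
      (mem_range_self t)
    rw [deriv_sub_const] at h1
    have h2 : Submodule.span ℝ ((fun t => γ t - x) '' univ) ≤ W := by
      rw [Submodule.span_le]
      rintro _ ⟨s, -, rfl⟩
      exact hW s
    exact closure_minimal h2 W.closed_of_finiteDimensional h1

theorem isClosed_coset (W : Submodule ℝ E) (x : E) : IsClosed {y | y - x ∈ W} :=
  W.closed_of_finiteDimensional.preimage (by fun_prop : Continuous fun y => y - x)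

theorem minPrinciple_of_escaping_curves {X : Set E} (hX : IsOpen X) {W : Submodule ℝ E}
    (hW : W ≠ ⊥)
    (h : ∀ K : Set E, K ⊆ X → IsCompact K → K.Nonempty →
      ∀ x ∈ X, Metric.infDist x Xᶜ < sInf ((fun y => Metric.infDist y Xᶜ) '' K) →
        ∃ γ : ℝ → E,
          WRegularOn W γ (Set.Ici 0) ∧ Set.MapsTo γ (Set.Ici 0) X ∧ γ 0 = x ∧
          γ '' Set.Ici 0 ∩ K = ∅ ∧ ApproachesBoundary X γ) (x : E) :
    MinPrinciple (fun y => Metric.infDist y Xᶜ) X {y | y - x ∈ W} := by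
  intro K hKF hK hKne
  set F : Set E := {y | y - x ∈ W} with hFdef
  set f : E → ℝ := fun y => Metric.infDist y Xᶜ with hf
  have hsub : bdryIn F K ⊆ K := bdryIn_subset hK.isClosed
  have hLne : (bdryIn F K).Nonempty :=
    bdryIn_nonempty (convex_coset W x).isPreconnected (fun y hy => (hKF hy).1) hKne
      fun hEq => not_isBounded_coset hW x (by simpa only [← hFdef, ← hEq] using hK.isBounded)
  have hbdd : BddBelow (f '' K) := ⟨0, by rintro _ ⟨y, -, rfl⟩; exact Metric.infDist_nonneg⟩
  refine le_antisymm (csInf_le_csInf hbdd (hLne.image _) (image_mono hsub)) ?_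
  by_contra! hlt
  obtain ⟨_, ⟨y, hy, rfl⟩, hyL⟩ := exists_lt_of_csInf_lt (hKne.image f) hlt
  obtain ⟨γ, hreg, -, h0, hdisj, happ⟩ := h (bdryIn F K) (fun z hz => (hKF (hsub hz)).2)
    (hK.of_isClosed_subset ((isClosed_coset W x).bdryIn K) hsub) hLne y (hKF hy).2 hyL
  have hXc : Xᶜ.Nonempty := by
    by_contra hcon
    rw [not_nonempty_iff_eq_empty] at hcon
    simp [hf, hcon, hLne] at hyL
  refine not_approachesBoundary hX hXc (fun z hz => (hKF hz).2) hK
    (mapsTo_of_disjoint_bdryIn (F := F) hK.isClosed hreg.1 (fun t ht => ?_) (h0 ▸ hy) ?_) happ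
  · have h1 : y - x ∈ W := (hKF hy).1
    simpa [hFdef, h0] using W.add_mem (hreg.sub_mem ht) h1
  · intro t ht hmem
    exact (hdisj.subset ⟨mem_image_of_mem γ ht, hmem⟩).elim

/-- The points joined to `x` inside a sublevel set of the boundary distance do not stay in a
compact part of `X`. -/
theorem not_bounded_of_minPrinciple {X : Set E} (hX : IsOpen X)
    {W : Submodule ℝ E} {x : E} (hx : x ∈ X) {m : ℝ} (hm : Metric.infDist x Xᶜ < m)
    (h : MinPrinciple (fun y => Metric.infDist y Xᶜ) X {y | y - x ∈ W})
    {ε R : ℝ} (hε : 0 < ε)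
    (hb : ∀ y, SmoothlyJoinedIn {y | y - x ∈ W ∧ y ∈ X ∧ Metric.infDist y Xᶜ < m} x y →
      ε ≤ Metric.infDist y Xᶜ ∧ ‖y‖ ≤ R) : False := by
  set F : Set E := {y | y - x ∈ W} with hFdef
  set f : E → ℝ := fun y => Metric.infDist y Xᶜ with hf
  have hfc : Continuous f := Metric.continuous_infDist_pt Xᶜ
  set S : Set E := {y | y - x ∈ W ∧ y ∈ X ∧ f y < m} with hS
  set Ω : Set E := {y | SmoothlyJoinedIn S x y} with hΩ
  have hxΩ : x ∈ Ω := SmoothlyJoinedIn.of_segment_subset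
    (by simpa [hS] using And.intro hx hm)
  have hKf : ∀ y ∈ closure Ω, ε ≤ f y := fun y hy =>
    closure_minimal (t := {y | ε ≤ f y}) (fun z hz => (hb z hz).1)
      (isClosed_le continuous_const hfc) hy
  have hKF : closure Ω ⊆ F ∩ X := fun y hy => by
    refine ⟨closure_minimal (fun z hz => hz.mem_right.1) (isClosed_coset W x) hy, ?_⟩
    by_contra hyX
    have h1 : f y = 0 := Metric.infDist_zero_of_mem hyX
    linarith [hKf y hy]
  have hK : IsCompact (closure Ω) :=
    ((isCompact_closedBall (0 : E) R).of_isClosed_subset isClosed_closure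
      (closure_minimal (fun z hz => by simpa using (hb z hz).2) Metric.isClosed_closedBall))
  have hKne : (closure Ω).Nonempty := ⟨x, subset_closure hxΩ⟩
  have hlow : ∀ p ∈ bdryIn F (closure Ω), m ≤ f p := by
    intro p hp
    obtain ⟨hpF, hpK, hpn⟩ := (mem_bdryIn_iff isClosed_closure).1 hp
    by_contra! hlt
    have hopen : IsOpen (X ∩ {y | f y < m}) := hX.inter (isOpen_lt hfc continuous_const)
    obtain ⟨r, hr, hball⟩ := Metric.isOpen_iff.1 hopen p ⟨(hKF hpK).2, hlt⟩
    obtain ⟨q, hq, hqr⟩ := Metric.mem_closure_iff.1 hpK r hr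
    have hconv : Convex ℝ (Metric.ball p r ∩ F) := (convex_ball p r).inter (convex_coset W x)
    have hsubS : Metric.ball p r ∩ F ⊆ S := fun z hz => ⟨hz.2, hball hz.1⟩
    apply hpn
    rw [mem_nhdsWithin_iff_exists_mem_nhds_inter]
    refine ⟨_, Metric.ball_mem_nhds p hr, fun z hz => subset_closure ?_⟩
    have hqm : q ∈ Metric.ball p r ∩ F := ⟨by rwa [Metric.mem_ball, dist_comm], hq.mem_right.1⟩
    exact hq.trans (.of_segment_subset ((hconv.segment_subset hqm hz).trans hsubS))
  have hmin := h _ hKF hK hKne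
  have hbdd : BddBelow (f '' closure Ω) :=
    ⟨0, by rintro _ ⟨y, -, rfl⟩; exact Metric.infDist_nonneg⟩
  have h1 : sInf (f '' closure Ω) ≤ f x := csInf_le hbdd ⟨x, subset_closure hxΩ, rfl⟩
  have h2 : ε ≤ sInf (f '' closure Ω) := by
    refine le_csInf (hKne.image f) ?_
    rintro _ ⟨y, hy, rfl⟩
    exact hKf y hy
  rcases (bdryIn F (closure Ω)).eq_empty_or_nonempty with he | hne
  · rw [he, image_empty, Real.sInf_empty] at hmin
    linarith
  · have h3 : m ≤ sInf (f '' bdryIn F (closure Ω)) := by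
      refine le_csInf (hne.image f) ?_
      rintro _ ⟨y, hy, rfl⟩
      exact hlow y hy
    have h4 : f x < m := hm
    linarith

theorem exists_escaping_curve {X : Set E} (hX : IsOpen X)
    {W : Submodule ℝ E} {x : E} (hx : x ∈ X) {m : ℝ} (hm : Metric.infDist x Xᶜ < m)
    (h : MinPrinciple (fun y => Metric.infDist y Xᶜ) X {y | y - x ∈ W}) :
    ∃ γ : ℝ → E, WRegularOn W γ (Ici 0) ∧ γ 0 = x ∧
      (∀ t, γ t ∈ X ∧ Metric.infDist (γ t) Xᶜ < m) ∧ ApproachesBoundary X γ := by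
  set S : Set E := {y | y - x ∈ W ∧ y ∈ X ∧ Metric.infDist y Xᶜ < m} with hS
  have hxx : SmoothlyJoinedIn S x x := SmoothlyJoinedIn.of_segment_subset
    (by simpa [hS] using And.intro hx hm)
  have hcurve : ∀ y : ℕ → E, (∀ k, SmoothlyJoinedIn S x (y k)) → ∃ γ : ℝ → E,
      WRegularOn W γ (Ici 0) ∧ γ 0 = x ∧ (∀ t, γ t ∈ X ∧ Metric.infDist (γ t) Xᶜ < m) ∧
        ∀ k : ℕ, γ ((k : ℝ) + 1) = y k := by
    intro y hy
    let z : ℕ → E := fun k => Nat.casesOn k x y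
    have hz : ∀ k, SmoothlyJoinedIn S x (z k) := fun k => by
      cases k with
      | zero => exact hxx
      | succ k => exact hy k
    obtain ⟨γ, hγ, hγS, hγz⟩ := SmoothlyJoinedIn.exists_contDiff_interpolating
      fun k => (hz k).symm.trans (hz (k + 1))
    refine ⟨γ, wRegularOn_of_contDiff hγ (fun t => (hγS t).1) _, by exact_mod_cast hγz 0,
      fun t => (hγS t).2, fun k => by simpa using hγz (k + 1)⟩
  have hu : Tendsto (fun k : ℕ => (k : ℝ) + 1) atTop atTop :=
    tendsto_atTop_add_const_right _ _ tendsto_natCast_atTop_atTop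
  by_cases hcase : ∀ ε > 0, ∃ y, SmoothlyJoinedIn S x y ∧ Metric.infDist y Xᶜ < ε
  · choose y hy hyd using fun k : ℕ => hcase (1 / ((k : ℝ) + 1)) (by positivity)
    obtain ⟨γ, h1, h2, h3, h4⟩ := hcurve y hy
    refine ⟨γ, h1, h2, h3, _, hu, Or.inl ?_⟩
    simp only [h4]
    exact squeeze_zero (fun k => Metric.infDist_nonneg) (fun k => (hyd k).le)
      tendsto_one_div_add_atTop_nhds_zero_nat
  · push Not at hcase
    obtain ⟨ε, hε, hlow⟩ := hcase
    have hunb : ∀ R : ℝ, ∃ y, SmoothlyJoinedIn S x y ∧ R < ‖y‖ := by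
      intro R
      by_contra! hcon
      exact not_bounded_of_minPrinciple hX hx hm h hε fun y hy => ⟨hlow y hy, hcon y hy⟩
    choose y hy hyR using fun k : ℕ => hunb k
    obtain ⟨γ, h1, h2, h3, h4⟩ := hcurve y hy
    refine ⟨γ, h1, h2, h3, _, hu, Or.inr ?_⟩
    simp only [h4]
    exact tendsto_atTop_mono (fun k => (hyR k).le) tendsto_natCast_atTop_atTop

end InnerProductSpace

theorem minimum_principle_iff_escaping_curves
    (n : ℕ) (X : Set (EuclideanSpace ℝ (Fin n))) (hX : IsOpen X)
    (W : Submodule ℝ (EuclideanSpace ℝ (Fin n))) (hW : W ≠ ⊥) :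
    (∀ x ∈ X, MinPrinciple (fun y => Metric.infDist y Xᶜ) X {y | y - x ∈ W}) ↔
    (∀ K : Set (EuclideanSpace ℝ (Fin n)), K ⊆ X → IsCompact K → K.Nonempty →
      ∀ x ∈ X, Metric.infDist x Xᶜ < sInf ((fun y => Metric.infDist y Xᶜ) '' K) →
        ∃ γ : ℝ → EuclideanSpace ℝ (Fin n),
          WRegularOn W γ (Set.Ici 0) ∧ Set.MapsTo γ (Set.Ici 0) X ∧ γ 0 = x ∧
          γ '' Set.Ici 0 ∩ K = ∅ ∧ ApproachesBoundary X γ) := by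
  refine ⟨fun h K _ _ _ x hx hlt => ?_,
    fun h x _ => minPrinciple_of_escaping_curves hX hW h x⟩
  obtain ⟨γ, hreg, h0, hγ, happ⟩ := exists_escaping_curve hX hx hlt (h x hx)
  refine ⟨γ, hreg, fun t _ => (hγ t).1, h0, ?_, happ⟩
  rw [eq_empty_iff_forall_notMem]
  rintro _ ⟨⟨t, -, rfl⟩, htK⟩
  refine (hγ t).2.not_ge (csInf_le ⟨0, ?_⟩ ⟨_, htK, rfl⟩)
  rintro _ ⟨y, -, rfl⟩
  exact Metric.infDist_nonneg
end

section
/- Let k ≥ 1 and m ≥ 1 be integers, let ξ, x ∈ ℝ^k and t ≥ 0. Then |ξ+tx|^{2m} + |ξ−tx|^{2m} ≥ 2(∑_{j=1}^k ξ_j^{2m} + t^{2m} ∑_{j=1}^k x_j^{2m}), where |·| denotes the Euclidean norm. In particular, sup_{|θ|≤t} |ξ+θx|^{2m} ≥ ∑_{j=1}^k ξ_j^{2m} + t^{2m} ∑_{j=1}^k x_j^{2m}. -/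
open Finset

theorem sum_pow_le_pow_sum_of_nonneg {ι : Type*} (s : Finset ι) (f : ι → ℝ)
    (hf : ∀ i ∈ s, 0 ≤ f i) {m : ℕ} (hm : m ≠ 0) :
    ∑ i ∈ s, f i ^ m ≤ (∑ i ∈ s, f i) ^ m := by
  obtain ⟨n, rfl⟩ := Nat.exists_eq_succ_of_ne_zero hm
  rw [pow_succ, mul_sum]
  refine sum_le_sum fun i hi => ?_
  rw [pow_succ]
  have h0 := hf i hi
  gcongr
  exact single_le_sum hf hi

theorem EuclideanSpace.sum_pow_two_mul_le_norm_sq_pow {ι : Type*} [Fintype ι]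
    (v : EuclideanSpace ℝ ι) {m : ℕ} (hm : m ≠ 0) :
    ∑ j, v j ^ (2 * m) ≤ (‖v‖ ^ 2) ^ m := by
  rw [EuclideanSpace.real_norm_sq_eq]
  simp_rw [pow_mul]
  exact sum_pow_le_pow_sum_of_nonneg _ _ (fun _ _ => sq_nonneg _) hm

theorem two_mul_norm_sq_add_norm_sq_pow_le {E : Type*} [NormedAddCommGroup E]
    [InnerProductSpace ℝ E] (u v : E) (m : ℕ) :
    2 * (‖u‖ ^ 2 + ‖v‖ ^ 2) ^ m ≤ ‖u + v‖ ^ (2 * m) + ‖u - v‖ ^ (2 * m) := by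
  have hp := parallelogram_law_with_norm ℝ u v
  have hc := (convexOn_pow (𝕜 := ℝ) m).2 (sq_nonneg ‖u + v‖) (sq_nonneg ‖u - v‖)
    (show (0 : ℝ) ≤ 1 / 2 by norm_num) (show (0 : ℝ) ≤ 1 / 2 by norm_num) (by norm_num)
  have he : (1 / 2 : ℝ) * ‖u + v‖ ^ 2 + 1 / 2 * ‖u - v‖ ^ 2 = ‖u‖ ^ 2 + ‖v‖ ^ 2 := by
    linarith
  simp only [smul_eq_mul, he] at hc
  rw [pow_mul, pow_mul]
  linarith

theorem norm_pow_add_sub_ge_and_sup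
    (k m : ℕ) (hk : 1 ≤ k) (hm : 1 ≤ m)
    (ξ x : EuclideanSpace ℝ (Fin k)) (t : ℝ) (ht : 0 ≤ t) :
    2 * ((∑ j, (ξ j) ^ (2 * m)) + t ^ (2 * m) * ∑ j, (x j) ^ (2 * m)) ≤
        ‖ξ + t • x‖ ^ (2 * m) + ‖ξ - t • x‖ ^ (2 * m) ∧
    (∑ j, (ξ j) ^ (2 * m)) + t ^ (2 * m) * ∑ j, (x j) ^ (2 * m) ≤
        sSup {r : ℝ | ∃ θ : ℝ, |θ| ≤ t ∧ r = ‖ξ + θ • x‖ ^ (2 * m)} := by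
  have hm0 : m ≠ 0 := by omega
  have main : 2 * ((∑ j, (ξ j) ^ (2 * m)) + t ^ (2 * m) * ∑ j, (x j) ^ (2 * m)) ≤
      ‖ξ + t • x‖ ^ (2 * m) + ‖ξ - t • x‖ ^ (2 * m) := by
    have h1 := EuclideanSpace.sum_pow_two_mul_le_norm_sq_pow ξ hm0
    have h2 := EuclideanSpace.sum_pow_two_mul_le_norm_sq_pow (t • x) hm0
    simp only [PiLp.smul_apply, smul_eq_mul, mul_pow, ← mul_sum] at h2
    have h3 := pow_add_pow_le (sq_nonneg ‖ξ‖) (sq_nonneg ‖t • x‖) hm0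
    have h4 := two_mul_norm_sq_add_norm_sq_pow_le ξ (t • x) m
    linarith
  refine ⟨main, ?_⟩
  have hb : BddAbove {r : ℝ | ∃ θ : ℝ, |θ| ≤ t ∧ r = ‖ξ + θ • x‖ ^ (2 * m)} := by
    refine ⟨(‖ξ‖ + t * ‖x‖) ^ (2 * m), ?_⟩
    rintro _ ⟨θ, hθ, rfl⟩
    gcongr
    refine (norm_add_le _ _).trans ?_
    rw [norm_smul, Real.norm_eq_abs]
    gcongr
  have hp := le_csSup hb ⟨t, (abs_of_nonneg ht).le, rfl⟩
  have hn := le_csSup hb ⟨-t, by rw [abs_neg, abs_of_nonneg ht], rfl⟩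
  rw [neg_smul, ← sub_eq_add_neg] at hn
  linarith
end
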